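/- Let B ⊆ X be finite, μ : B → (0,∞), p ∈ (1,∞] with Hölder conjugate q, ω : X → ℝ bounded, T₁ ≤ T₂ ≤ T₃ < T₄, β ∈ (1, 1 + 1/q), and let v ≥ 0 be a bounded supersolution of the Δ_ω-heat equation on [T₁,T₄] × B. Then for all s ≥ 1: ∫_{T₂}^{T₃} ‖v_t^{sβ}‖_q dt ≤ [ s( (1 ∨ μ(B)^{1/p})/(T₄−T₃) + ‖Deg‖_p )·‖μ^{−1}‖_p^q ]^{β−1} · ( ∫_{T₁}^{T₄} ‖v_t^s‖_q dt )^{β}, where all norms are ℓ^p(B,μ)-norms, Deg(x) = (1/m(x))Σ_y b(x,y) and μ^{−1}(x) = 1/μ(x). -/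

import Mathlib

open Real MeasureTheory
open scoped ENNReal NNReal

noncomputable section

namespace GraphHeat

variable {X : Type*}

/-- weighted volume of a set of vertices -/
def vol (m : X → ℝ) (A : Set X) : ℝ := ∑' y : A, m y

/-- squared `ℓ²(X,m)` norm -/
def sq2 (m : X → ℝ) (f : X → ℝ) : ℝ := ∑' x, m x * f x ^ 2

/-- `ℓ²(X,m)` norm -/
def l2n (m : X → ℝ) (f : X → ℝ) : ℝ := Real.sqrt (sq2 m f)

/-- `ℓ^p(X,m)` norm for a real exponent `p` -/
def lpn (m : X → ℝ) (p : ℝ) (f : X → ℝ) : ℝ := (∑' x, m x * |f x| ^ p) ^ (1 / p)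

/-- membership in `ℓ²(X,m)` -/
def Meml2 (m : X → ℝ) (f : X → ℝ) : Prop := Summable (fun x => m x * f x ^ 2)

/-- the graph Laplacian in divergence form -/
def lap (b : X → X → ℝ) (m : X → ℝ) (f : X → ℝ) (x : X) : ℝ :=
  (1 / m x) * ∑' y, b x y * (f x - f y)

/-- the sandwiched Laplacian `Δ_ω v = e^ω Δ (e^{-ω} v)` -/
def lapOm (b : X → X → ℝ) (m : X → ℝ) (ω : X → ℝ) (f : X → ℝ) (x : X) : ℝ :=
  Real.exp (ω x) * lap b m (fun y => Real.exp (-ω y) * f y) x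

/-- the modulus of the gradient `|∇ f|(x)` -/
def gradN (b : X → X → ℝ) (m : X → ℝ) (f : X → ℝ) (x : X) : ℝ :=
  Real.sqrt ((1 / m x) * ∑' y, b x y * (f x - f y) ^ 2)

/-- `h(ω) = sup_x Σ_y (b(x,y)/m(x)) |∇_{xy} e^ω ∇_{xy} e^{-ω}|` -/
def hOm (b : X → X → ℝ) (m : X → ℝ) (ω : X → ℝ) : ℝ :=
  ⨆ x, ∑' y, (b x y / m x) *
    |(Real.exp (ω x) - Real.exp (ω y)) * (Real.exp (-ω x) - Real.exp (-ω y))|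

/-- boundedness of a function on the vertex set -/
def Bd (ω : X → ℝ) : Prop := ∃ M, ∀ x, |ω x| ≤ M

/-- the distance ball `B_x(R)` -/
def ball (ρ : X → X → ℝ) (x : X) (R : ℝ) : Set X := {y | ρ x y ≤ R}

/-- the combinatorial interior `A°` of a set `A` -/
def intr (b : X → X → ℝ) (A : Set X) : Set X := {x ∈ A | ∀ y, y ∉ A → b x y = 0}

/-- the weighted vertex degree `Deg(x) = deg(x)/m(x)` -/
def Deg (b : X → X → ℝ) (m : X → ℝ) (x : X) : ℝ := (1 / m x) * ∑' y, b x y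

/-- the graph Gaussian `ζ_S(r,t)` -/
def zeta (S r t : ℝ) : ℝ :=
  (1 / S ^ 2) * (r * S * Real.arsinh (r * S / t) + t - Real.sqrt (t ^ 2 + r ^ 2 * S ^ 2))

/-- `σ(r,t) = 2 S⁻²(√(1 + r²S²/t²) − 1)` -/
def sigm (S r t : ℝ) : ℝ := (2 / S ^ 2) * (Real.sqrt (1 + r ^ 2 * S ^ 2 / t ^ 2) - 1)

/-- `ℓ^p`-norm over a finite set `B` with weight `μ`, `p ∈ [1,∞]` -/
def lpF {X : Type*} (B : Finset X) (μ : X → ℝ) (p : ℝ≥0∞) (f : X → ℝ) : ℝ :=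
  if p = ∞ then ⨆ x ∈ (B : Set X), |f x|
  else (∑ x ∈ B, μ x * |f x| ^ p.toReal) ^ (1 / p.toReal)

/-- `ℓ^p`-norm over a countable weighted space, with values in `ℝ≥0∞` -/
def lpE {B : Type*} (μ : B → ℝ) (p : ℝ≥0∞) (f : B → ℝ) : ℝ≥0∞ :=
  if p = ∞ then ⨆ x, (‖f x‖₊ : ℝ≥0∞)
  else (∑' x, ENNReal.ofReal (μ x) * (‖f x‖₊ : ℝ≥0∞) ^ p.toReal) ^ (1 / p.toReal)

/-- the `p`-mean `D_p(x,R)` of the weighted degree over the ball `B_x(R)` -/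
def Dp (b : X → X → ℝ) (m : X → ℝ) (ρ : X → X → ℝ) (p : ℝ≥0∞) (x : X) (R : ℝ) : ℝ :=
  if p = ∞ then ⨆ y ∈ ball ρ x R, Deg b m y
  else ((1 / vol m (ball ρ x R)) * ∑' y : ball ρ x R, m y * Deg b m y ^ p.toReal) ^ (1 / p.toReal)

/-- the `p`-mean `M_p(x,R)` of `1/m` over the ball `B_x(R)` -/
def Mp (m : X → ℝ) (ρ : X → X → ℝ) (p : ℝ≥0∞) (x : X) (R : ℝ) : ℝ :=
  if p = ∞ then ⨆ y ∈ ball ρ x R, 1 / m y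
  else ((1 / vol m (ball ρ x R)) * ∑' y : ball ρ x R, m y * (1 / m y) ^ p.toReal) ^ (1 / p.toReal)

/-- `κ(r) = ⌊√(r/4S) − 2⌋` -/
def kappa (S r : ℝ) : ℤ := ⌊Real.sqrt (r / (4 * S)) - 2⌋

/-- `θ(r) = (1/2)β^{−κ(r)}` -/
def theta (S β r : ℝ) : ℝ := (1 / 2) * β ^ (-(kappa S r))

/-- the error function `Γ_x(r)` -/
def Gam (b : X → X → ℝ) (m : X → ℝ) (ρ : X → X → ℝ) (S : ℝ) (p : ℝ≥0∞) (q β : ℝ)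
    (x : X) (r : ℝ) : ℝ :=
  ((1 + r ^ 2 * Dp b m ρ p x r) * Mp m ρ p x r ^ q * vol m (ball ρ x r) ^ q) ^ (theta S β r)

/-- the Sobolev inequality `S(n, R, R)` at `x` with constant `CS` -/
def Sob (b : X → X → ℝ) (m : X → ℝ) (ρ : X → X → ℝ) (x : X) (n CS R : ℝ) : Prop :=
  ∀ u : X → ℝ, Function.support u ⊆ intr b (ball ρ x R) →
    vol m (ball ρ x R) ^ (2 / n) / (CS * R ^ 2) * lpn m (2 * n / (n - 2)) u ^ 2 ≤
      sq2 m (gradN b m u) + (1 / R ^ 2) * sq2 m u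

/-- the volume doubling property `V(d, R₁, R₂)` at `x` with constant `CD` -/
def VD (m : X → ℝ) (ρ : X → X → ℝ) (x : X) (d CD R1 R2 : ℝ) : Prop :=
  ∀ r1 r2, R1 ≤ r1 → r1 ≤ r2 → r2 ≤ R2 →
    vol m (ball ρ x r2) ≤ CD * (r2 / r1) ^ d * vol m (ball ρ x r1)

/-- the sandwiched semigroup `P^ω_t = e^ω P_t e^{-ω}` -/
def POm (P : ℝ → (X → ℝ) → X → ℝ) (ω : X → ℝ) (t : ℝ) (f : X → ℝ) : X → ℝ :=
  fun x => Real.exp (ω x) * P t (fun y => Real.exp (-ω y) * f y) x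

/-- the `ℓ² → ℓ²` operator norm -/
def opn (m : X → ℝ) (A : (X → ℝ) → X → ℝ) : ℝ :=
  sSup {r | ∃ f, Meml2 m f ∧ l2n m f ≤ 1 ∧ r = l2n m (A f)}

/-- the constant `C_β` -/
def Cbeta (β : ℝ) : ℝ := 4 ^ (((4 + 1 / Real.log β) + β / (β - 1)) / (β - 1))

/-- the constant `C_{d,n}` -/
def Cdn (CS CD d n : ℝ) : ℝ :=
  max 1 CD * max 1 (CD ^ (n / 2 + 1) * CS ^ (n / 2)) *
    (10 : ℝ) ^ (8 * ((n + 2) * (d + 1) + n ^ 2 + n) + 1)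

theorem lapOm_le_Deg_mul {m : X → ℝ} (hm : ∀ x, 0 < m x) {b : X → X → ℝ}
    (hb0 : ∀ x y, 0 ≤ b x y) (hlf : ∀ x, {y | b x y ≠ 0}.Finite) (ω : X → ℝ) {f : X → ℝ}
    (hf : ∀ x, 0 ≤ f x) (x : X) : lapOm b m ω f x ≤ Deg b m x * f x := by
  have summable_mul : ∀ g : X → ℝ, Summable fun y => b x y * g y := fun g =>
    summable_of_hasFiniteSupport ((hlf x).subset fun y hy => left_ne_zero_of_mul hy)
  have h : ∑' y, b x y * (exp (-ω x) * f x - exp (-ω y) * f y)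
      ≤ (∑' y, b x y) * (exp (-ω x) * f x) := by
    rw [← tsum_mul_right]
    refine (summable_mul _).tsum_le_tsum (fun y => ?_) (summable_mul _)
    exact mul_le_mul_of_nonneg_left
      (sub_le_self _ (mul_nonneg (exp_pos _).le (hf y))) (hb0 x y)
  have hexp : exp (ω x) * exp (-ω x) = 1 := by rw [← exp_add, add_neg_cancel, exp_zero]
  unfold lapOm lap Deg
  calc exp (ω x) * (1 / m x * ∑' y, b x y * (exp (-ω x) * f x - exp (-ω y) * f y))
      ≤ exp (ω x) * (1 / m x * ((∑' y, b x y) * (exp (-ω x) * f x))) := by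
        have := hm x
        gcongr
    _ = (exp (ω x) * exp (-ω x)) * (1 / m x * (∑' y, b x y) * f x) := by ring
    _ = 1 / m x * (∑' y, b x y) * f x := by rw [hexp, one_mul]

theorem Deg_nonneg {m : X → ℝ} (hm : ∀ x, 0 < m x) {b : X → X → ℝ}
    (hb0 : ∀ x y, 0 ≤ b x y) (x : X) : 0 ≤ Deg b m x :=
  mul_nonneg (one_div_nonneg.2 (hm x).le) (tsum_nonneg (hb0 x))

theorem rpow_mul_abs_le_lpF {B : Finset X} {μ : X → ℝ} (hμ : ∀ x ∈ B, 0 < μ x) {p : ℝ≥0∞}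
    (hp : p ≠ 0) (f : X → ℝ) {x : X} (hx : x ∈ B) :
    μ x ^ (1 / p.toReal) * |f x| ≤ lpF B μ p f := by
  unfold lpF
  split_ifs with h
  · subst h
    have hbdd : BddAbove (Set.range fun y => ⨆ _ : y ∈ (B : Set X), |f y|) := by
      refine ⟨∑ y ∈ B, |f y|, ?_⟩
      rintro _ ⟨y, rfl⟩
      refine Real.iSup_le (fun hy => ?_) (Finset.sum_nonneg fun _ _ => abs_nonneg _)
      exact Finset.single_le_sum (f := fun y => |f y|) (fun _ _ => abs_nonneg _)
        (Finset.mem_coe.1 hy)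
    have hle := le_ciSup hbdd x
    rw [ciSup_pos (Finset.mem_coe.2 hx)] at hle
    simpa using hle
  · have hp0 : 0 < p.toReal := ENNReal.toReal_pos hp h
    have hterm : ∀ y ∈ B, 0 ≤ μ y * |f y| ^ p.toReal := fun y hy =>
      mul_nonneg (hμ y hy).le (rpow_nonneg (abs_nonneg _) _)
    calc μ x ^ (1 / p.toReal) * |f x| = (μ x * |f x| ^ p.toReal) ^ (1 / p.toReal) := by
          rw [mul_rpow (hμ x hx).le (rpow_nonneg (abs_nonneg _) _), ← rpow_mul (abs_nonneg _),
            mul_one_div_cancel hp0.ne', rpow_one]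
      _ ≤ _ := rpow_le_rpow (hterm x hx)
          (Finset.single_le_sum (f := fun y => μ y * |f y| ^ p.toReal) hterm hx)
          (one_div_nonneg.2 hp0.le)

theorem lpF_nonneg {B : Finset X} {μ : X → ℝ} (hμ : ∀ x ∈ B, 0 < μ x) (p : ℝ≥0∞)
    (f : X → ℝ) : 0 ≤ lpF B μ p f := by
  unfold lpF
  split_ifs
  · exact Real.iSup_nonneg fun x => Real.iSup_nonneg fun _ => abs_nonneg _
  · exact rpow_nonneg (Finset.sum_nonneg fun y hy =>
      mul_nonneg (hμ y hy).le (rpow_nonneg (abs_nonneg _) _)) _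

theorem continuousOn_lpF {B : Finset X} {μ : X → ℝ} {p : ℝ≥0∞} (hp : p ≠ ∞)
    {f : ℝ → X → ℝ} {S : Set ℝ} (hf : ∀ x ∈ B, ContinuousOn (fun t => f t x) S) :
    ContinuousOn (fun t => lpF B μ p (f t)) S := by
  simp only [lpF, if_neg hp]
  refine ContinuousOn.rpow_const (continuousOn_finsetSum _ fun x hx =>
    continuousOn_const.mul ((hf x hx).abs.rpow_const fun _ _ =>
      Or.inr ENNReal.toReal_nonneg)) fun _ _ => Or.inr (one_div_nonneg.2 ENNReal.toReal_nonneg)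

theorem lpF_rpow_le {B : Finset X} {μ : X → ℝ} (hμ : ∀ x ∈ B, 0 < μ x) {p : ℝ≥0∞}
    (hp0 : p ≠ 0) (hp : p ≠ ∞) {f : X → ℝ} (hf : ∀ x ∈ B, 0 ≤ f x) {s β K : ℝ}
    (hβ : 1 < β) (hK0 : 0 ≤ K) (hK : ∀ x ∈ B, f x ^ s ≤ K) :
    lpF B μ p (fun x => f x ^ (s * β)) ≤ K ^ (β - 1) * lpF B μ p (fun x => f x ^ s) := by
  have hp' : 0 < p.toReal := ENNReal.toReal_pos hp0 hp
  have hKβ : 0 ≤ K ^ (β - 1) := rpow_nonneg hK0 _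
  simp only [lpF, if_neg hp]
  have hsum : ∀ g : X → ℝ, 0 ≤ ∑ x ∈ B, μ x * |g x| ^ p.toReal := fun g =>
    Finset.sum_nonneg fun y hy => mul_nonneg (hμ y hy).le (rpow_nonneg (abs_nonneg _) _)
  calc (∑ x ∈ B, μ x * |f x ^ (s * β)| ^ p.toReal) ^ (1 / p.toReal)
      ≤ ((K ^ (β - 1)) ^ p.toReal * ∑ x ∈ B, μ x * |f x ^ s| ^ p.toReal) ^ (1 / p.toReal) := by
        refine rpow_le_rpow (hsum _) ?_ (one_div_nonneg.2 hp'.le)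
        rw [Finset.mul_sum]
        refine Finset.sum_le_sum fun x hx => ?_
        have hfs : 0 ≤ f x ^ s := rpow_nonneg (hf x hx) _
        have hle : f x ^ (s * β) ≤ K ^ (β - 1) * f x ^ s := by
          rw [rpow_mul (hf x hx)]
          calc (f x ^ s) ^ β = (f x ^ s) ^ (β - 1) * f x ^ s := by
                rw [← rpow_add_one' hfs (by linarith), sub_add_cancel]
            _ ≤ K ^ (β - 1) * f x ^ s := by
                gcongr
                exact hK x hx
        rw [abs_of_nonneg (rpow_nonneg (hf x hx) _), abs_of_nonneg hfs, mul_left_comm,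
          ← mul_rpow hKβ hfs]
        exact mul_le_mul_of_nonneg_left (rpow_le_rpow (rpow_nonneg (hf x hx) _) hle hp'.le)
          (hμ x hx).le
    _ = _ := by
        rw [mul_rpow (rpow_nonneg hKβ _) (hsum _), ← rpow_mul hKβ,
          mul_one_div_cancel hp'.ne', rpow_one]

theorem inv_le_lpF_inv_rpow {B : Finset X} {μ : X → ℝ} (hμ : ∀ x ∈ B, 0 < μ x)
    {p q : ℝ≥0∞} (hp : p ≠ 0) (hq : 0 < q.toReal)
    (hpq : 1 / p.toReal + 1 / q.toReal = 1) {x : X} (hx : x ∈ B) :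
    (μ x)⁻¹ ≤ lpF B μ p (fun x => (μ x)⁻¹) ^ q.toReal := by
  have hx0 := hμ x hx
  have h := rpow_mul_abs_le_lpF hμ hp (fun x => (μ x)⁻¹) hx
  calc (μ x)⁻¹ = (μ x ^ (1 / p.toReal) * |(μ x)⁻¹|) ^ q.toReal := by
        rw [abs_of_pos (inv_pos.2 hx0), ← rpow_neg_one, ← rpow_add hx0, ← rpow_mul hx0.le]
        congr 1
        have : 1 / p.toReal + -1 = -(1 / q.toReal) := by linarith
        rw [this]
        field_simp
    _ ≤ _ := rpow_le_rpow (by positivity) h hq.le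

theorem toReal_conjugate {p q : ℝ≥0∞} (hp : 1 < p) (hpq : 1 / p + 1 / q = 1) :
    0 < q.toReal ∧ q ≠ 0 ∧ q ≠ ∞ ∧ 1 / p.toReal + 1 / q.toReal = 1 := by
  have hq0 : q ≠ 0 := by
    rintro rfl
    simp at hpq
  have hqt : q ≠ ∞ := by
    rintro rfl
    simp only [one_div, ENNReal.inv_top, add_zero, ENNReal.inv_eq_one] at hpq
    exact hp.ne' hpq
  have hp0 : p ≠ 0 := (zero_lt_one.trans hp).ne'
  refine ⟨ENNReal.toReal_pos hq0 hqt, hq0, hqt, ?_⟩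
  have h := congrArg ENNReal.toReal hpq
  rw [ENNReal.toReal_add (by simpa using hp0) (by simpa using hq0)] at h
  simpa using h

/-- A nonnegative function with `g' ≥ -D g` is controlled at the left endpoint by its mean. -/
theorem rpow_le_mul_integral_of_deriv_ge {a c D s : ℝ} (hac : a < c) (hD : 0 ≤ D) (hs : 1 ≤ s)
    {g g' : ℝ → ℝ} (hg0 : ∀ t ∈ Set.Icc a c, 0 ≤ g t)
    (hg : ∀ t ∈ Set.Icc a c, HasDerivWithinAt g (g' t) (Set.Icc a c) t)
    (hge : ∀ t ∈ Set.Icc a c, -(D * g t) ≤ g' t) :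
    g a ^ s ≤ (1 / (c - a) + s * D) * ∫ t in a..c, g t ^ s := by
  have hs0 : 0 ≤ s := zero_le_one.trans hs
  have hcont : ContinuousOn (fun t => g t ^ s) (Set.Icc a c) :=
    ContinuousOn.rpow_const (fun t ht => (hg t ht).continuousWithinAt) fun _ _ => Or.inr hs0
  have hint : IntervalIntegrable (fun t => g t ^ s) volume a c :=
    hcont.intervalIntegrable_of_Icc hac.le
  let G : ℝ → ℝ := fun τ =>
    (c - τ) * g τ ^ s + (1 + s * D * (c - a)) * ∫ t in a..τ, g t ^ s
  have hG : ∀ τ ∈ Set.Ioo a c, HasDerivAt G (-1 * g τ ^ s + (c - τ) * (g' τ * s * g τ ^ (s - 1))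
      + (1 + s * D * (c - a)) * g τ ^ s) τ := by
    intro τ hτ
    have hnhds : Set.Icc a c ∈ nhds τ := Icc_mem_nhds hτ.1 hτ.2
    have hderiv := ((hg τ (Set.Ioo_subset_Icc_self hτ)).hasDerivAt hnhds).rpow_const
      (p := s) (Or.inr hs)
    have hintτ : IntervalIntegrable (fun t => g t ^ s) volume a τ :=
      (hcont.mono (Set.Icc_subset_Icc_right hτ.2.le)).intervalIntegrable_of_Icc hτ.1.le
    have hFTC := intervalIntegral.integral_hasDerivAt_right hintτ
      ((hcont.mono Set.Ioo_subset_Icc_self).stronglyMeasurableAtFilter isOpen_Ioo τ hτ)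
      (hcont.continuousAt hnhds)
    exact (((hasDerivAt_id τ).const_sub c).mul hderiv).add (hFTC.const_mul _)
  have hGcont : ContinuousOn G (Set.Icc a c) := by
    refine ((continuousOn_const.sub continuousOn_id).mul hcont).add
      (continuousOn_const.mul ?_)
    have := intervalIntegral.continuousOn_primitive_interval (a := a) (b := c)
      (f := fun t => g t ^ s) (μ := volume) (by
        rw [Set.uIcc_of_le hac.le]
        exact hcont.integrableOn_Icc)
    rwa [Set.uIcc_of_le hac.le] at this
  have hmono : MonotoneOn G (Set.Icc a c) := by
    refine monotoneOn_of_deriv_nonneg (convex_Icc a c) hGcont ?_ ?_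
    · rw [interior_Icc]
      exact fun τ hτ => (hG τ hτ).differentiableAt.differentiableWithinAt
    · rw [interior_Icc]
      intro τ hτ
      rw [(hG τ hτ).deriv]
      have hτ' := Set.Ioo_subset_Icc_self hτ
      have hpow : 0 ≤ g τ ^ (s - 1) := rpow_nonneg (hg0 τ hτ') _
      have hsplit : g τ ^ s = g τ * g τ ^ (s - 1) := by
        rw [mul_comm, ← rpow_add_one' (hg0 τ hτ') (by linarith), sub_add_cancel]
      have hfirst : (c - τ) * (-(D * g τ) * s * g τ ^ (s - 1))
          ≤ (c - τ) * (g' τ * s * g τ ^ (s - 1)) := by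
        have : 0 ≤ c - τ := sub_nonneg.2 hτ.2.le
        have := hge τ hτ'
        gcongr
      have hrest : 0 ≤ (τ - a) * (D * s * (g τ * g τ ^ (s - 1))) :=
        mul_nonneg (sub_nonneg.2 hτ.1.le)
          (mul_nonneg (mul_nonneg hD hs0) (mul_nonneg (hg0 τ hτ') hpow))
      rw [hsplit]
      linarith
  have hle := hmono (Set.left_mem_Icc.2 hac.le) (Set.right_mem_Icc.2 hac.le) hac.le
  simp only [G, intervalIntegral.integral_same, mul_zero, add_zero, sub_self, zero_mul,
    zero_add] at hle
  have hpos : 0 < c - a := sub_pos.2 hac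
  refine le_of_mul_le_mul_left (hle.trans_eq ?_) hpos
  field_simp

/-- The iteration step in time for supersolutions. -/
theorem iteration_step_time {X : Type*} [Countable X]
    (m : X → ℝ) (hm : ∀ x, 0 < m x)
    (b : X → X → ℝ) (hb0 : ∀ x y, 0 ≤ b x y) (hbs : ∀ x y, b x y = b y x)
    (hbl : ∀ x, b x x = 0) (hlf : ∀ x, {y | b x y ≠ 0}.Finite)
    (hconn : ∀ x y, Relation.ReflTransGen (fun u v => 0 < b u v) x y)
    (B : Finset X) (μ : X → ℝ) (hμ : ∀ x ∈ B, 0 < μ x)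
    (p q : ℝ≥0∞) (hp : 1 < p) (hpq : 1 / p + 1 / q = 1)
    (ω : X → ℝ) (hω : Bd ω)
    (T₁ T₂ T₃ T₄ : ℝ) (hT₁₂ : T₁ ≤ T₂) (hT₂₃ : T₂ ≤ T₃) (hT₃₄ : T₃ < T₄)
    (β : ℝ) (hβ1 : 1 < β) (hβ2 : β < 1 + 1 / q.toReal)
    (v v' : ℝ → X → ℝ)
    (hvnn : ∀ t ∈ Set.Icc T₁ T₄, ∀ z, 0 ≤ v t z)
    (hvbd : ∃ M, ∀ t ∈ Set.Icc T₁ T₄, ∀ z, v t z ≤ M)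
    (hv : ∀ z ∈ B, ∀ t ∈ Set.Icc T₁ T₄,
      HasDerivWithinAt (fun u => v u z) (v' t z) (Set.Icc T₁ T₄) t)
    (hv' : ∀ z ∈ B, ContinuousOn (fun t => v' t z) (Set.Icc T₁ T₄))
    (hsup : ∀ t ∈ Set.Icc T₁ T₄, ∀ z ∈ B, 0 ≤ v' t z + lapOm b m ω (v t) z)
    (s : ℝ) (hs : 1 ≤ s) :
    (∫ t in T₂..T₃, lpF B μ q (fun x => v t x ^ (s * β)))
      ≤ (s * (max 1 ((∑ x ∈ B, μ x) ^ (1 / p.toReal)) / (T₄ - T₃) + lpF B μ p (Deg b m)) *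
            lpF B μ p (fun x => (μ x)⁻¹) ^ q.toReal) ^ (β - 1) *
          (∫ t in T₁..T₄, lpF B μ q (fun x => v t x ^ s)) ^ β := by
  obtain ⟨hq, hq0, hqt, hpq'⟩ := toReal_conjugate hp hpq
  have hp0 : p ≠ 0 := (zero_lt_one.trans hp).ne'
  have hs0 : 0 < s := zero_lt_one.trans_le hs
  have hvcont : ∀ z ∈ B, ContinuousOn (fun t => v t z) (Set.Icc T₁ T₄) := fun z hz t ht =>
    (hv z hz t ht).continuousWithinAt
  have hpow : ∀ r : ℝ, 0 ≤ r → ∀ z ∈ B, ContinuousOn (fun t => v t z ^ r) (Set.Icc T₁ T₄) :=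
    fun r hr z hz => (hvcont z hz).rpow_const fun _ _ => Or.inr hr
  have hNcont : ∀ r : ℝ, 0 ≤ r →
      ContinuousOn (fun t => lpF B μ q (fun x => v t x ^ r)) (Set.Icc T₁ T₄) :=
    fun r hr => continuousOn_lpF hqt (hpow r hr)
  have h₁₄ : T₁ ≤ T₄ := (hT₁₂.trans hT₂₃).trans hT₃₄.le
  have hsub : Set.Icc T₂ T₃ ⊆ Set.Icc T₁ T₄ := Set.Icc_subset_Icc hT₁₂ hT₃₄.le
  have hint : IntervalIntegrable (fun t => lpF B μ q (fun x => v t x ^ s)) volume T₁ T₄ :=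
    (hNcont s hs0.le).intervalIntegrable_of_Icc h₁₄
  set I := ∫ t in T₁..T₄, lpF B μ q (fun x => v t x ^ s) with hI
  set A := s * (max 1 ((∑ x ∈ B, μ x) ^ (1 / p.toReal)) / (T₄ - T₃) + lpF B μ p (Deg b m))
    with hA
  set N := lpF B μ p (fun x => (μ x)⁻¹) ^ q.toReal with hN
  have hT : 0 < T₄ - T₃ := sub_pos.2 hT₃₄
  have hI0 : 0 ≤ I := intervalIntegral.integral_nonneg h₁₄ fun _ _ => lpF_nonneg hμ _ _
  have hN0 : 0 ≤ N := rpow_nonneg (lpF_nonneg hμ _ _) _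
  have hA0 : 0 ≤ A := mul_nonneg hs0.le (add_nonneg
    (div_nonneg (zero_le_one.trans (le_max_left _ _)) hT.le) (lpF_nonneg hμ _ _))
  have hpointwise : ∀ t ∈ Set.Icc T₂ T₃, ∀ x ∈ B, v t x ^ s ≤ A * N * I := by
    intro t ht x hx
    have hx0 := hμ x hx
    have hD := Deg_nonneg hm hb0 x
    have ht4 : t < T₄ := ht.2.trans_lt hT₃₄
    have ht1 : T₁ ≤ t := hT₁₂.trans ht.1
    have hsub' : Set.Icc t T₄ ⊆ Set.Icc T₁ T₄ := Set.Icc_subset_Icc_left ht1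
    have hmean := rpow_le_mul_integral_of_deriv_ge ht4 hD hs
      (g := fun τ => v τ x) (g' := fun τ => v' τ x) (fun τ hτ => hvnn τ (hsub' hτ) x)
      (fun τ hτ => (hv x hx τ (hsub' hτ)).mono hsub') (fun τ hτ => by
        have h1 := hsup τ (hsub' hτ) x hx
        have h2 := lapOm_le_Deg_mul hm hb0 hlf ω (hvnn τ (hsub' hτ)) x
        linarith)
    have hintx : IntervalIntegrable (fun τ => v τ x ^ s) volume T₁ T₄ :=
      (hpow s hs0.le x hx).intervalIntegrable_of_Icc h₁₄
    set J := ∫ τ in T₁..T₄, v τ x ^ s with hJ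
    have hJle : ∫ τ in t..T₄, v τ x ^ s ≤ J := by
      refine intervalIntegral.integral_mono_interval ht1 ht4.le le_rfl ?_ hintx
      filter_upwards [ae_restrict_mem measurableSet_Ioc] with τ hτ
      exact rpow_nonneg (hvnn τ (Set.Ioc_subset_Icc_self hτ) x) _
    have hJ0 : 0 ≤ J := intervalIntegral.integral_nonneg h₁₄ fun τ hτ =>
      rpow_nonneg (hvnn τ hτ x) _
    have hJI : μ x ^ (1 / q.toReal) * J ≤ I := by
      rw [hJ, ← intervalIntegral.integral_const_mul]
      refine intervalIntegral.integral_mono_on h₁₄ (hintx.const_mul _) hint fun τ hτ => ?_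
      have h := rpow_mul_abs_le_lpF hμ hq0 (fun y => v τ y ^ s) hx
      rwa [abs_of_nonneg (rpow_nonneg (hvnn τ hτ x) _)] at h
    have hcoef : μ x ^ (1 / p.toReal) * (1 / (T₄ - t) + s * Deg b m x) ≤ A := by
      have hDeg := rpow_mul_abs_le_lpF hμ hp0 (Deg b m) hx
      rw [abs_of_nonneg hD] at hDeg
      have hmass : μ x ^ (1 / p.toReal) ≤ max 1 ((∑ x ∈ B, μ x) ^ (1 / p.toReal)) :=
        (rpow_le_rpow hx0.le (Finset.single_le_sum (fun y hy => (hμ y hy).le) hx)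
          (one_div_nonneg.2 ENNReal.toReal_nonneg)).trans (le_max_right _ _)
      have htime : μ x ^ (1 / p.toReal) * (1 / (T₄ - t))
          ≤ max 1 ((∑ x ∈ B, μ x) ^ (1 / p.toReal)) / (T₄ - T₃) := by
        rw [mul_one_div]
        exact div_le_div₀ (zero_le_one.trans (le_max_left _ _)) hmass hT
          (sub_le_sub_left ht.2 _)
      have htime0 : 0 ≤ max 1 ((∑ x ∈ B, μ x) ^ (1 / p.toReal)) / (T₄ - T₃) :=
        div_nonneg (zero_le_one.trans (le_max_left _ _)) hT.le
      calc μ x ^ (1 / p.toReal) * (1 / (T₄ - t) + s * Deg b m x)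
          = μ x ^ (1 / p.toReal) * (1 / (T₄ - t))
            + s * (μ x ^ (1 / p.toReal) * Deg b m x) := by ring
        _ ≤ s * (max 1 ((∑ x ∈ B, μ x) ^ (1 / p.toReal)) / (T₄ - T₃))
            + s * lpF B μ p (Deg b m) :=
          add_le_add (htime.trans (le_mul_of_one_le_left htime0 hs))
            (mul_le_mul_of_nonneg_left hDeg hs0.le)
        _ = A := by rw [hA, mul_add]
    have hsplit : (μ x)⁻¹ * (μ x ^ (1 / p.toReal) * μ x ^ (1 / q.toReal)) = 1 := by
      rw [← rpow_add hx0, hpq', rpow_one, inv_mul_cancel₀ hx0.ne']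
    have hcoef0 : 0 ≤ 1 / (T₄ - t) + s * Deg b m x :=
      add_nonneg (one_div_nonneg.2 (sub_nonneg.2 ht4.le)) (mul_nonneg hs0.le hD)
    calc v t x ^ s ≤ (1 / (T₄ - t) + s * Deg b m x) * J :=
          hmean.trans (mul_le_mul_of_nonneg_left hJle hcoef0)
      _ = ((μ x)⁻¹ * (μ x ^ (1 / p.toReal) * μ x ^ (1 / q.toReal)))
          * ((1 / (T₄ - t) + s * Deg b m x) * J) := by rw [hsplit, one_mul]
      _ = (μ x ^ (1 / p.toReal) * (1 / (T₄ - t) + s * Deg b m x)) * (μ x)⁻¹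
          * (μ x ^ (1 / q.toReal) * J) := by ring
      _ ≤ A * N * I := by
          have hNle : (μ x)⁻¹ ≤ N := inv_le_lpF_inv_rpow hμ hp0 hq hpq' hx
          gcongr
  have hANI : 0 ≤ A * N * I := mul_nonneg (mul_nonneg hA0 hN0) hI0
  calc (∫ t in T₂..T₃, lpF B μ q (fun x => v t x ^ (s * β)))
      ≤ ∫ t in T₂..T₃, (A * N * I) ^ (β - 1) * lpF B μ q (fun x => v t x ^ s) := by
        refine intervalIntegral.integral_mono_on hT₂₃ ?_ ?_ fun t ht => ?_
        · exact ((hNcont (s * β) (by positivity)).mono hsub).intervalIntegrable_of_Icc hT₂₃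
        · exact (((hNcont s hs0.le).mono hsub).intervalIntegrable_of_Icc hT₂₃).const_mul _
        · exact lpF_rpow_le hμ hq0 hqt (fun x _ => hvnn t (hsub ht) x) hβ1 hANI
            (hpointwise t ht)
    _ = (A * N * I) ^ (β - 1) * ∫ t in T₂..T₃, lpF B μ q (fun x => v t x ^ s) :=
        intervalIntegral.integral_const_mul _ _
    _ ≤ (A * N * I) ^ (β - 1) * I := by
        refine mul_le_mul_of_nonneg_left ?_ (rpow_nonneg hANI _)
        exact intervalIntegral.integral_mono_interval hT₁₂ hT₂₃ hT₃₄.le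
          (Filter.Eventually.of_forall fun t => lpF_nonneg hμ _ _) hint
    _ = (A * N) ^ (β - 1) * I ^ β := by
        rw [mul_rpow (mul_nonneg hA0 hN0) hI0, mul_assoc,
          ← rpow_add_one' hI0 (by linarith), sub_add_cancel]

end GraphHeat
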